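/- Let 𝕍 = V ⊕ V* = E ⊕ F be a Lagrangian splitting defining a bivector π ∈ ∧²V, and let φ, ψ ∈ ∧V* be pure spinors defining E, F respectively. Then φᵀ ∧ ψ = exp(-ι(π))(φᵀ ∧ ψ)^[top], where (φᵀ ∧ ψ)^[top] is the (nonzero) top-degree component, ι(π) is contraction by the bivector π, and ᵀ is the standard anti-involution of the exterior algebra. -/

import Mathlib

set_option synthInstance.maxHeartbeats 1000000
set_option maxHeartbeats 1000000

open ExteriorAlgebra CliffordAlgebra Module

/-- Clifford action of `V ⊕ V*` on `∧ V*`. -/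
noncomputable def cliffordRho {K V : Type*} [Field K] [AddCommGroup V] [Module K V]
    (w : V × Module.Dual K V) (φ : ExteriorAlgebra K (Module.Dual K V)) :
    ExteriorAlgebra K (Module.Dual K V) :=
  CliffordAlgebra.contractLeft (Module.Dual.eval K V w.1) φ + ExteriorAlgebra.ι K w.2 * φ

/-- The reversal anti-automorphism `ᵀ` of `∧ V*`. -/
noncomputable def revE {K V : Type*} [Field K] [AddCommGroup V] [Module K V]
    (x : ExteriorAlgebra K (Module.Dual K V)) : ExteriorAlgebra K (Module.Dual K V) :=
  CliffordAlgebra.reverse (Q := (0 : QuadraticForm K (Module.Dual K V))) x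

/-- Contraction by a vector `v ∈ V`, as an endomorphism of `∧ V*`, linearly in `v`. -/
noncomputable def contrV (K V : Type*) [Field K] [AddCommGroup V] [Module K V] :
    V →ₗ[K] Module.End K (ExteriorAlgebra K (Module.Dual K V)) :=
  (CliffordAlgebra.contractLeft (Q := (0 : QuadraticForm K (Module.Dual K V)))).comp
    (Module.Dual.eval K V)

/-- The algebra morphism `ι : ∧ V → End(∧ V*)` extending contraction `ι(v)`. -/
noncomputable def iotaHom (K V : Type*) [Field K] [AddCommGroup V] [Module K V] :
    ExteriorAlgebra K V →ₐ[K] Module.End K (ExteriorAlgebra K (Module.Dual K V)) :=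
  ExteriorAlgebra.lift K
    ⟨contrV K V, fun v => LinearMap.ext fun x =>
      CliffordAlgebra.contractLeft_contractLeft _ x⟩

/-- Truncated exponential in an algebra, valid for nilpotent arguments of index `≤ n`. -/
noncomputable def expA {K A : Type*} [Field K] [Ring A] [Algebra K A] (n : ℕ) (a : A) : A :=
  ∑ k ∈ Finset.range (n + 1), (k.factorial : K)⁻¹ • a ^ k

namespace PureSpin

section General

variable {K M : Type*} [Field K] [AddCommGroup M] [Module K M]

/-- Contraction by a covector on the exterior algebra. -/
noncomputable def cl (d : Module.Dual K M) : ExteriorAlgebra K M →ₗ[K] ExteriorAlgebra K M :=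
  CliffordAlgebra.contractLeft (Q := (0 : QuadraticForm K M)) d

/-- Degree projection. -/
noncomputable def pr (k : ℕ) : ExteriorAlgebra K M →ₗ[K] ExteriorAlgebra K M :=
  GradedAlgebra.proj (fun i : ℕ => ⋀[K]^i M) k

/-- Grade involution. -/
noncomputable def inv' : ExteriorAlgebra K M →ₐ[K] ExteriorAlgebra K M :=
  CliffordAlgebra.involute (Q := (0 : QuadraticForm K M))

/-- Reversal. -/
noncomputable def rv : ExteriorAlgebra K M →ₗ[K] ExteriorAlgebra K M :=
  CliffordAlgebra.reverse (Q := (0 : QuadraticForm K M))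

theorem left_ind {P : ExteriorAlgebra K M → Prop} (h0 : ∀ r : K, P (algebraMap _ _ r))
    (h1 : ∀ x y, P x → P y → P (x + y))
    (h2 : ∀ (a : M) x, P x → P (ExteriorAlgebra.ι K a * x)) (x) : P x :=
  CliffordAlgebra.left_induction (Q := (0 : QuadraticForm K M)) h0 h1 (fun x m => h2 m x) x

theorem cl_ι_mul (d : Module.Dual K M) (a : M) (x : ExteriorAlgebra K M) :
    cl d (ExteriorAlgebra.ι K a * x) = d a • x - ExteriorAlgebra.ι K a * cl d x :=
  CliffordAlgebra.contractLeft_ι_mul d a x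

theorem cl_algebraMap (d : Module.Dual K M) (r : K) :
    cl d (algebraMap K (ExteriorAlgebra K M) r) = 0 :=
  CliffordAlgebra.contractLeft_algebraMap _ d r

theorem cl_ι (d : Module.Dual K M) (a : M) :
    cl d (ExteriorAlgebra.ι K a) = algebraMap K _ (d a) :=
  CliffordAlgebra.contractLeft_ι _ d a

theorem cl_comm (d d' : Module.Dual K M) (x : ExteriorAlgebra K M) :
    cl d (cl d' x) = - cl d' (cl d x) :=
  CliffordAlgebra.contractLeft_comm d d' x

theorem cl_add (d d' : Module.Dual K M) : cl (d + d') = cl d + cl d' :=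
  map_add (CliffordAlgebra.contractLeft (Q := (0 : QuadraticForm K M))) d d'

theorem inv_ι (a : M) : inv' (ExteriorAlgebra.ι K a) = - ExteriorAlgebra.ι K a :=
  CliffordAlgebra.involute_ι a

theorem inv_inv (x : ExteriorAlgebra K M) : inv' (inv' x) = x :=
  CliffordAlgebra.involute_involute x

theorem rv_mul (x y : ExteriorAlgebra K M) : rv (x * y) = rv y * rv x :=
  CliffordAlgebra.reverse.map_mul x y

theorem rv_ι (a : M) : rv (ExteriorAlgebra.ι K a) = ExteriorAlgebra.ι K a :=
  CliffordAlgebra.reverse_ι a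

theorem rv_rv (x : ExteriorAlgebra K M) : rv (rv x) = x :=
  CliffordAlgebra.reverse_reverse x

theorem rv_algebraMap (r : K) : rv (algebraMap K (ExteriorAlgebra K M) r) = algebraMap K _ r :=
  CliffordAlgebra.reverse.commutes r

theorem ι_swap (a b : M) : ExteriorAlgebra.ι K a * ExteriorAlgebra.ι K b
    = - (ExteriorAlgebra.ι K b * ExteriorAlgebra.ι K a) :=
  eq_neg_of_add_eq_zero_left (ExteriorAlgebra.ι_add_mul_swap a b)

theorem mul_ι_eq (x : ExteriorAlgebra K M) (a : M) :
    x * ExteriorAlgebra.ι K a = ExteriorAlgebra.ι K a * inv' x := by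
  induction x using left_ind with
  | h0 r => simp [Algebra.commutes]
  | h1 x y hx hy => simp [add_mul, mul_add, hx, hy]
  | h2 b x hx =>
    rw [mul_assoc, hx, ← mul_assoc, ι_swap b a, map_mul, inv_ι]
    simp [mul_assoc]

theorem cl_mul (d : Module.Dual K M) (x y : ExteriorAlgebra K M) :
    cl d (x * y) = cl d x * y + inv' x * cl d y := by
  induction x using left_ind with
  | h0 r =>
    rw [cl_algebraMap, ← Algebra.smul_def, map_smul, AlgHom.commutes, ← Algebra.smul_def]; simp
  | h1 x z hx hz => simp only [add_mul, map_add, hx, hz]; abel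
  | h2 b x hx =>
    rw [mul_assoc, cl_ι_mul, hx, cl_ι_mul, map_mul, inv_ι]
    simp only [mul_add, sub_mul, smul_mul_assoc, neg_mul, mul_assoc]
    abel

theorem cl_inv (d : Module.Dual K M) (x : ExteriorAlgebra K M) :
    cl d (inv' x) = - inv' (cl d x) := by
  induction x using left_ind with
  | h0 r => simp [cl_algebraMap]
  | h1 x z hx hz => simp only [map_add, hx, hz]; abel
  | h2 b x hx =>
    rw [map_mul, inv_ι, neg_mul, map_neg, cl_ι_mul, cl_ι_mul, map_sub, map_mul, inv_ι, hx]
    simp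

theorem rv_cl (d : Module.Dual K M) (x : ExteriorAlgebra K M) :
    rv (cl d x) = inv' (cl d (rv x)) := by
  induction x using left_ind with
  | h0 r => simp [cl_algebraMap, rv_algebraMap]
  | h1 x z hx hz => simp only [map_add, hx, hz]
  | h2 b x hx =>
    rw [cl_ι_mul, map_sub, rv_mul, rv_mul, rv_ι, hx, cl_mul, cl_ι, map_add, map_mul, map_mul,
      inv_inv, inv_ι, AlgHom.commutes, ← Algebra.commutes, ← Algebra.smul_def, map_smul]
    simp only [mul_neg]
    abel

theorem pr_mem (k : ℕ) (x : ExteriorAlgebra K M) : pr k x ∈ ⋀[K]^k M := by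
  rw [pr, GradedAlgebra.proj_apply]; exact SetLike.coe_mem _

theorem pr_of_mem {k : ℕ} {x : ExteriorAlgebra K M} (hx : x ∈ ⋀[K]^k M) : pr k x = x := by
  rw [pr, GradedAlgebra.proj_apply]; exact DirectSum.decompose_of_mem_same _ hx

theorem pr_of_mem_ne {k l : ℕ} {x : ExteriorAlgebra K M} (hx : x ∈ ⋀[K]^k M) (h : k ≠ l) :
    pr l x = 0 := by
  rw [pr, GradedAlgebra.proj_apply]; exact DirectSum.decompose_of_mem_ne _ hx h

theorem pr_pr (k : ℕ) (x : ExteriorAlgebra K M) : pr k (pr k x) = pr k x :=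
  pr_of_mem (pr_mem k x)

theorem ext_pr {x : ExteriorAlgebra K M} (h : ∀ k, pr k x = 0) : x = 0 := by
  classical
  have := DirectSum.sum_support_decompose (fun i : ℕ => ⋀[K]^i M) x
  rw [← this]
  exact Finset.sum_eq_zero fun k _ => h k

theorem exists_bound (x : ExteriorAlgebra K M) : ∃ N, ∀ k, N ≤ k → pr k x = 0 := by
  classical
  refine ⟨(DirectSum.decompose (fun i : ℕ => ⋀[K]^i M) x).support.sup id + 1, fun k hk => ?_⟩
  rw [pr, GradedAlgebra.proj_apply]
  by_contra h
  have h1 : k ∈ (DirectSum.decompose (fun i : ℕ => ⋀[K]^i M) x).support := by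
    rw [DFinsupp.mem_support_iff]
    intro h'; apply h; rw [h']; rfl
  have := Finset.le_sup (f := id) h1
  simp only [id] at this
  omega

theorem ι_mem (a : M) : ExteriorAlgebra.ι K a ∈ ⋀[K]^1 M := by
  rw [ExteriorAlgebra.exteriorPower, pow_one]
  exact ⟨a, rfl⟩

theorem pr_succ_ι_mul (k : ℕ) (a : M) (x : ExteriorAlgebra K M) :
    pr (k + 1) (ExteriorAlgebra.ι K a * x) = ExteriorAlgebra.ι K a * pr k x := by
  simp only [pr, GradedAlgebra.proj_apply]
  rw [add_comm]
  exact DirectSum.coe_decompose_mul_add_of_left_mem (fun i : ℕ => ⋀[K]^i M) (ι_mem a)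

theorem pr_zero_ι_mul (a : M) (x : ExteriorAlgebra K M) :
    pr 0 (ExteriorAlgebra.ι K a * x) = 0 := by
  simp only [pr, GradedAlgebra.proj_apply]
  exact DirectSum.coe_decompose_mul_of_left_mem_of_not_le (fun i : ℕ => ⋀[K]^i M) (ι_mem a)
    (by simp)

theorem algebraMap_mem (r : K) : algebraMap K (ExteriorAlgebra K M) r ∈ ⋀[K]^0 M := by
  rw [ExteriorAlgebra.exteriorPower, pow_zero]
  exact Submodule.algebraMap_mem r

theorem pr_zero_eq (x : ExteriorAlgebra K M) : ∃ r, pr 0 x = algebraMap K _ r := by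
  have := pr_mem 0 x
  rw [ExteriorAlgebra.exteriorPower, pow_zero, Submodule.mem_one] at this
  obtain ⟨r, hr⟩ := this
  exact ⟨r, hr.symm⟩

theorem pr_cl (d : Module.Dual K M) (k : ℕ) (x : ExteriorAlgebra K M) :
    pr k (cl d x) = cl d (pr (k + 1) x) := by
  induction x using left_ind generalizing k with
  | h0 r => rw [cl_algebraMap, pr_of_mem_ne (algebraMap_mem r) (by omega)]; simp
  | h1 x z hx hz => simp only [map_add, hx, hz]
  | h2 b x hx =>
    rw [cl_ι_mul, pr_succ_ι_mul, cl_ι_mul, map_sub, map_smul]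
    congr 1
    cases k with
    | zero =>
      obtain ⟨r, hr⟩ := pr_zero_eq x
      rw [pr_zero_ι_mul, hr, cl_algebraMap, mul_zero]
    | succ k => rw [pr_succ_ι_mul, hx]

theorem euler [FiniteDimensional K M] (k : ℕ) (x : ExteriorAlgebra K M) :
    ∑ i, ExteriorAlgebra.ι K (Module.finBasis K M i) *
      cl ((Module.finBasis K M).coord i) (pr k x) = (k : K) • pr k x := by
  induction x using left_ind generalizing k with
  | h0 r =>
    rcases Nat.eq_zero_or_pos k with rfl | hk
    · rw [pr_of_mem (algebraMap_mem r)]; simp [cl_algebraMap]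
    · rw [pr_of_mem_ne (algebraMap_mem r) (by omega)]; simp
  | h1 x z hx hz => simp only [map_add, mul_add, Finset.sum_add_distrib, hx, hz, smul_add]
  | h2 a x hx =>
    cases k with
    | zero => rw [pr_zero_ι_mul]; simp
    | succ k =>
      rw [pr_succ_ι_mul]
      have h1 : ∀ i, ExteriorAlgebra.ι K (Module.finBasis K M i) *
          cl ((Module.finBasis K M).coord i) (ExteriorAlgebra.ι K a * pr k x) =
          ExteriorAlgebra.ι K ((Module.finBasis K M).coord i a • Module.finBasis K M i) * pr k x
          + ExteriorAlgebra.ι K a * (ExteriorAlgebra.ι K (Module.finBasis K M i) *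
          cl ((Module.finBasis K M).coord i) (pr k x)) := by
        intro i
        rw [cl_ι_mul, mul_sub, ← mul_assoc, ι_swap, map_smul]
        simp only [mul_smul_comm, smul_mul_assoc, neg_mul, mul_assoc, sub_neg_eq_add]
      simp only [h1, Finset.sum_add_distrib]
      rw [← Finset.sum_mul, ← Finset.mul_sum, hx, ← map_sum]
      have h2 : ∑ i, (Module.finBasis K M).coord i a • Module.finBasis K M i = a := by
        simp only [Module.Basis.coord_apply]
        exact (Module.finBasis K M).sum_repr a
      rw [h2, mul_smul_comm]
      push_cast
      rw [add_smul, one_smul, add_comm]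

theorem scalar_of_cl [CharZero K] [FiniteDimensional K M] {x : ExteriorAlgebra K M}
    (h : ∀ d : Module.Dual K M, cl d x = 0) : ∃ r, x = algebraMap K _ r := by
  have h1 : ∀ k, pr (k + 1) x = 0 := by
    intro k
    have := euler (k + 1) x
    simp only [← pr_cl, h, map_zero, mul_zero, Finset.sum_const_zero] at this
    have h3 := smul_eq_zero.1 this.symm
    rcases h3 with h3 | h3
    · exact absurd h3 (Nat.cast_ne_zero.2 (by omega))
    · exact h3
  obtain ⟨r, hr⟩ := pr_zero_eq x
  refine ⟨r, ?_⟩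
  rw [← sub_eq_zero]
  apply ext_pr
  intro k
  cases k with
  | zero => rw [map_sub, hr, pr_of_mem (algebraMap_mem r), sub_self]
  | succ k => rw [map_sub, h1, pr_of_mem_ne (algebraMap_mem r) (by omega), sub_self]

theorem zero_of_ι_mul [CharZero K] [FiniteDimensional K M] {x : ExteriorAlgebra K M} {k : ℕ}
    (hk : k ≠ Module.finrank K M)
    (h : ∀ a : M, ExteriorAlgebra.ι K a * pr k x = 0) : pr k x = 0 := by
  have h0 := euler k x
  have h1 : ∀ i, ExteriorAlgebra.ι K (Module.finBasis K M i) *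
      cl ((Module.finBasis K M).coord i) (pr k x) = pr k x := by
    intro i
    have h2 := cl_ι_mul ((Module.finBasis K M).coord i) (Module.finBasis K M i) (pr k x)
    rw [h, map_zero] at h2
    have h3 : (Module.finBasis K M).coord i (Module.finBasis K M i) = 1 := by simp
    rw [h3, one_smul] at h2
    exact (sub_eq_zero.1 h2.symm).symm
  simp only [h1, Finset.sum_const, Finset.card_univ, Fintype.card_fin] at h0
  rw [← Nat.cast_smul_eq_nsmul K, ← sub_eq_zero, ← sub_smul, smul_eq_zero, sub_eq_zero] at h0
  rcases h0 with h0 | h0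
  · exact absurd (Nat.cast_injective h0).symm hk
  · exact h0

theorem pr_big [FiniteDimensional K M] {k : ℕ} (hk : Module.finrank K M < k)
    (x : ExteriorAlgebra K M) : pr k x = 0 := by
  have h1 : Module.finrank K (⋀[K]^k M) = 0 := by
    rw [exteriorPower.finrank_eq, Nat.choose_eq_zero_of_lt hk]
  have h2 := Module.finrank_zero_iff.1 h1
  have := Subsingleton.elim (⟨pr k x, pr_mem k x⟩ : ⋀[K]^k M) 0
  exact congrArg Subtype.val this

theorem descent {S T : Type*} [AddCommGroup S] (Fil : ℕ → S → Prop) (op : T → S → S)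
    (P : S → Prop) (h0 : ∀ x, Fil 0 x → x = 0) (h1 : ∀ m t x, Fil (m + 1) x → Fil m (op t x))
    (hP : ∀ t x, P x → P (op t x)) (m : ℕ) (x : S) (hx : Fil m x) (hx0 : x ≠ 0) (hPx : P x) :
    ∃ y, y ≠ 0 ∧ P y ∧ ∀ t, op t y = 0 := by
  induction m generalizing x with
  | zero => exact absurd (h0 x hx) hx0
  | succ m ih =>
    by_cases h : ∀ t, op t x = 0
    · exact ⟨x, hx0, hPx, h⟩
    · push Not at h
      obtain ⟨t, ht⟩ := h
      exact ih (op t x) (h1 m t x hx) ht (hP t x hPx)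

theorem pr_inv (k : ℕ) (x : ExteriorAlgebra K M) : pr k (inv' x) = inv' (pr k x) := by
  induction x using left_ind generalizing k with
  | h0 r =>
    rw [AlgHom.commutes]
    rcases Nat.eq_zero_or_pos k with rfl | hk
    · rw [pr_of_mem (algebraMap_mem r), AlgHom.commutes]
    · rw [pr_of_mem_ne (algebraMap_mem r) (by omega)]; simp
  | h1 x z hx hz => simp only [map_add, hx, hz]
  | h2 a x hx =>
    rw [map_mul, inv_ι, neg_mul, map_neg]
    cases k with
    | zero => rw [pr_zero_ι_mul, pr_zero_ι_mul]; simp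
    | succ k => rw [pr_succ_ι_mul, pr_succ_ι_mul, hx, map_mul, inv_ι, neg_mul]

/-- Nondegeneracy of the wedge pairing. -/
theorem nondeg [CharZero K] [FiniteDimensional K M] {x : ExteriorAlgebra K M} (hx : x ≠ 0) :
    ∃ y, pr (Module.finrank K M) (x * y) ≠ 0 := by
  obtain ⟨y, hy0, ⟨z, rfl⟩, hy⟩ := descent
    (Fil := fun m (y : ExteriorAlgebra K M) => ∀ k, k + m ≤ Module.finrank K M → pr k y = 0)
    (op := fun (a : M) y => y * ExteriorAlgebra.ι K a)
    (P := fun y => ∃ z, y = x * z)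
    (fun y h => by
      apply ext_pr
      intro k
      by_cases hk : k ≤ Module.finrank K M
      · exact h k hk
      · exact pr_big (by omega) y)
    (fun m a y h k hk => by
      rw [mul_ι_eq]
      cases k with
      | zero => rw [pr_zero_ι_mul]
      | succ k => rw [pr_succ_ι_mul, pr_inv, h k (by omega), map_zero, mul_zero])
    (fun a y h => by
      obtain ⟨z, rfl⟩ := h
      exact ⟨z * ExteriorAlgebra.ι K a, mul_assoc _ _ _⟩)
    (Module.finrank K M + 1) x (fun k hk => by omega) hx ⟨1, by simp⟩
  refine ⟨z, fun h => hy0 ?_⟩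
  rw [← inv_inv (x * z)]
  have h1 : inv' (x * z) = 0 := by
    apply ext_pr
    intro k
    by_cases hk : k = Module.finrank K M
    · rw [hk, pr_inv, h, map_zero]
    · apply zero_of_ι_mul hk
      intro a
      have h2 := hy a
      rw [mul_ι_eq] at h2
      rw [← pr_succ_ι_mul, h2, map_zero]
  rw [h1, map_zero]

/-- A nonzero subspace stable under contraction and multiplication is everything. -/
theorem irred [CharZero K] [FiniteDimensional K M] (N : Submodule K (ExteriorAlgebra K M))
    {x : ExteriorAlgebra K M} (hx : x ≠ 0) (hxN : x ∈ N)
    (h1 : ∀ (d : Module.Dual K M) y, y ∈ N → cl d y ∈ N)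
    (h2 : ∀ (a : M) y, y ∈ N → ExteriorAlgebra.ι K a * y ∈ N) (y : ExteriorAlgebra K M) :
    y ∈ N := by
  obtain ⟨M0, hM0⟩ := exists_bound x
  obtain ⟨z, hz0, hzN, hz⟩ := descent
    (Fil := fun m (y : ExteriorAlgebra K M) => ∀ k, m ≤ k → pr k y = 0)
    (op := fun (d : Module.Dual K M) y => cl d y)
    (P := fun y => y ∈ N)
    (fun y h => ext_pr fun k => h k (Nat.zero_le k))
    (fun m d y h k hk => by rw [pr_cl, h _ (by omega), map_zero])
    (fun d y h => h1 d y h) M0 x hM0 hx hxN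
  obtain ⟨r, rfl⟩ := scalar_of_cl hz
  have hr : r ≠ 0 := by rintro rfl; simp at hz0
  induction y using left_ind with
  | h0 s =>
    have := N.smul_mem (s * r⁻¹) hzN
    rw [Algebra.smul_def, ← map_mul, mul_assoc, inv_mul_cancel₀ hr, mul_one] at this
    exact this
  | h1 x y hx hy => exact N.add_mem hx hy
  | h2 a x hx => exact h2 a x hx

end General

section Spin

variable {K V : Type*} [Field K] [AddCommGroup V] [Module K V]

/-- Vanishing in degrees at least `m`. -/
def FilLt (m : ℕ) (x : ExteriorAlgebra K (Module.Dual K V)) : Prop := ∀ k, m ≤ k → pr k x = 0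

theorem iotaHom_ι (v : V) (x : ExteriorAlgebra K (Module.Dual K V)) :
    iotaHom K V (ExteriorAlgebra.ι K v) x = cl (Module.Dual.eval K V v) x := by
  rw [iotaHom, ExteriorAlgebra.lift_ι_apply]; rfl

theorem ind2 {P : ExteriorAlgebra K V → Prop}
    (h1 : ∀ a b, P (ExteriorAlgebra.ι K a * ExteriorAlgebra.ι K b))
    (h2 : ∀ x y, P x → P y → P (x + y)) {π : ExteriorAlgebra K V} (hπ : π ∈ ⋀[K]^2 V) : P π := by
  rw [ExteriorAlgebra.exteriorPower, pow_two] at hπ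
  refine Submodule.mul_induction_on hπ ?_ h2
  rintro _ ⟨a, rfl⟩ _ ⟨b, rfl⟩
  exact h1 a b

theorem D_ι_mul {π : ExteriorAlgebra K V} (hπ : π ∈ ⋀[K]^2 V) (γ : Module.Dual K V)
    (x : ExteriorAlgebra K (Module.Dual K V)) :
    iotaHom K V π (ExteriorAlgebra.ι K γ * x) =
      ExteriorAlgebra.ι K γ * iotaHom K V π x - iotaHom K V (cl γ π) x := by
  refine ind2 (P := fun π => iotaHom K V π (ExteriorAlgebra.ι K γ * x) =
      ExteriorAlgebra.ι K γ * iotaHom K V π x - iotaHom K V (cl γ π) x) ?_ ?_ hπ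
  · intro a b
    rw [cl_ι_mul, cl_ι, ← Algebra.commutes, ← Algebra.smul_def, map_mul (iotaHom K V), map_sub,
      map_smul, map_smul]
    simp only [Module.End.mul_apply, iotaHom_ι, cl_ι_mul, map_sub, map_smul, LinearMap.sub_apply,
      LinearMap.smul_apply, Module.Dual.eval_apply]
    abel
  · intro y z hy hz
    simp only [map_add, LinearMap.add_apply, hy, hz, mul_add]
    abel

theorem D_cl {π : ExteriorAlgebra K V} (hπ : π ∈ ⋀[K]^2 V) (v : V)
    (x : ExteriorAlgebra K (Module.Dual K V)) :
    iotaHom K V π (cl (Module.Dual.eval K V v) x) =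
      cl (Module.Dual.eval K V v) (iotaHom K V π x) := by
  refine ind2 (P := fun π => iotaHom K V π (cl (Module.Dual.eval K V v) x) =
      cl (Module.Dual.eval K V v) (iotaHom K V π x)) ?_ ?_ hπ
  · intro a b
    simp only [map_mul, Module.End.mul_apply, iotaHom_ι]
    rw [cl_comm _ (Module.Dual.eval K V v) x, map_neg, cl_comm _ (Module.Dual.eval K V v), neg_neg]
  · intro y z hy hz
    simp only [map_add, LinearMap.add_apply, hy, hz]

theorem Fil_cl {m : ℕ} {x : ExteriorAlgebra K (Module.Dual K V)} (h : FilLt (m + 1) x)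
    (d : Module.Dual K (Module.Dual K V)) : FilLt m (cl d x) := by
  intro k hk
  rw [pr_cl, h _ (by omega), map_zero]

theorem Fil_D {π : ExteriorAlgebra K V} (hπ : π ∈ ⋀[K]^2 V) {m : ℕ}
    {x : ExteriorAlgebra K (Module.Dual K V)} (h : FilLt (m + 1) x) :
    FilLt m (iotaHom K V π x) := by
  refine ind2 (P := fun π => FilLt m (iotaHom K V π x)) ?_ ?_ hπ
  · intro a b
    simp only [map_mul, Module.End.mul_apply, iotaHom_ι]
    intro k hk
    rw [pr_cl, pr_cl, h _ (by omega), map_zero, map_zero]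
  · intro y z hy hz k hk
    simp only [map_add, LinearMap.add_apply, hy k hk, hz k hk, add_zero]

theorem Fil_D_pow {π : ExteriorAlgebra K V} (hπ : π ∈ ⋀[K]^2 V) (j : ℕ) {m : ℕ}
    {x : ExteriorAlgebra K (Module.Dual K V)} (h : FilLt (m + j) x) :
    FilLt m ((iotaHom K V π ^ j) x) := by
  induction j generalizing x with
  | zero => simpa using h
  | succ j ih =>
    rw [pow_succ, Module.End.mul_apply]
    exact ih (Fil_D hπ h)

theorem D_pow_cl {π : ExteriorAlgebra K V} (hπ : π ∈ ⋀[K]^2 V) (v : V) (j : ℕ)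
    (x : ExteriorAlgebra K (Module.Dual K V)) :
    (iotaHom K V π ^ j) (cl (Module.Dual.eval K V v) x) =
      cl (Module.Dual.eval K V v) ((iotaHom K V π ^ j) x) := by
  induction j with
  | zero => simp
  | succ j ih => rw [pow_succ', Module.End.mul_apply, Module.End.mul_apply, ih, D_cl hπ]

theorem ι_D_pow {π : ExteriorAlgebra K V} (hπ : π ∈ ⋀[K]^2 V) {γ : Module.Dual K V} {v : V}
    (hγ : cl γ π = ExteriorAlgebra.ι K v) (j : ℕ)
    {x : ExteriorAlgebra K (Module.Dual K V)} (hx : ExteriorAlgebra.ι K γ * x = 0) :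
    ExteriorAlgebra.ι K γ * (iotaHom K V π ^ (j + 1)) x =
      ((j + 1 : ℕ) : K) • cl (Module.Dual.eval K V v) ((iotaHom K V π ^ j) x) := by
  have key : ∀ y, ExteriorAlgebra.ι K γ * iotaHom K V π y =
      iotaHom K V π (ExteriorAlgebra.ι K γ * y) + cl (Module.Dual.eval K V v) y := by
    intro y
    rw [D_ι_mul hπ, hγ, iotaHom_ι]; abel
  induction j with
  | zero => simp [key, hx]
  | succ j ih =>
    rw [pow_succ', Module.End.mul_apply, key, ih, map_smul, D_cl hπ,
      ← Module.End.mul_apply (iotaHom K V π), ← pow_succ']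
    push_cast
    simp only [add_smul, one_smul]

/-- `exp(-ι(π)) μ` solves the equation. -/
theorem exp_solves [CharZero K] {π : ExteriorAlgebra K V} (hπ : π ∈ ⋀[K]^2 V)
    {γ : Module.Dual K V} {v : V} (hγ : cl γ π = ExteriorAlgebra.ι K v) (n : ℕ)
    {x : ExteriorAlgebra K (Module.Dual K V)} (hx : ExteriorAlgebra.ι K γ * x = 0)
    (hF : FilLt (n + 1) x) :
    ExteriorAlgebra.ι K γ * expA (K := K) n (-(iotaHom K V π)) x +
      cl (Module.Dual.eval K V v) (expA (K := K) n (-(iotaHom K V π)) x) = 0 := by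
  have h : ∀ m : ℕ, ExteriorAlgebra.ι K γ * expA (K := K) m (-(iotaHom K V π)) x +
      cl (Module.Dual.eval K V v) (expA (K := K) m (-(iotaHom K V π)) x) =
      ((m.factorial : K)⁻¹ * (-1) ^ m) •
        cl (Module.Dual.eval K V v) ((iotaHom K V π ^ m) x) := by
    intro m
    induction m with
    | zero => simp [expA, hx]
    | succ m ih =>
      have e : expA (K := K) (m + 1) (-(iotaHom K V π)) x =
          expA (K := K) m (-(iotaHom K V π)) x +
          (((m + 1).factorial : K)⁻¹ * (-1) ^ (m + 1)) • (iotaHom K V π ^ (m + 1)) x := by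
        have e2 : (-(iotaHom K V π)) ^ (m + 1) =
            ((-1 : K) ^ (m + 1)) • (iotaHom K V π) ^ (m + 1) := by
          rw [← neg_one_smul K (iotaHom K V π), smul_pow]
        rw [expA, Finset.sum_range_succ, e2, smul_smul]
        rfl
      rw [e, mul_add, map_add, add_add_add_comm, ih, mul_smul_comm, ι_D_pow hπ hγ m hx, map_smul,
        smul_smul, ← add_assoc, ← add_smul]
      have : ((m.factorial : K)⁻¹ * (-1) ^ m) + (((m + 1).factorial : K)⁻¹ * (-1) ^ (m + 1))
          * ((m + 1 : ℕ) : K) = 0 := by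
        have h1 : (m.factorial : K) ≠ 0 := Nat.cast_ne_zero.2 m.factorial_ne_zero
        have h2 : ((m + 1 : ℕ) : K) ≠ 0 := Nat.cast_ne_zero.2 (by omega)
        rw [Nat.factorial_succ, Nat.cast_mul, pow_succ]
        field_simp
        ring
      rw [this, zero_smul, zero_add]
  rw [h n, ← D_pow_cl hπ]
  have h0 : FilLt 0 ((iotaHom K V π ^ n) (cl (Module.Dual.eval K V v) x)) := by
    apply Fil_D_pow hπ
    rw [zero_add]
    exact Fil_cl hF _
  rw [ext_pr (fun k => h0 k (Nat.zero_le k)), smul_zero]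

theorem pr_exp {π : ExteriorAlgebra K V} (hπ : π ∈ ⋀[K]^2 V) (n : ℕ)
    {x : ExteriorAlgebra K (Module.Dual K V)} (hF : FilLt (n + 1) x) :
    pr n (expA (K := K) n (-(iotaHom K V π)) x) = pr n x := by
  rw [expA, Finset.sum_range_succ', LinearMap.add_apply, map_add, LinearMap.sum_apply, map_sum,
    Finset.sum_eq_zero]
  · simp
  · intro j _
    rw [← neg_one_smul K (iotaHom K V π), smul_pow]
    simp only [LinearMap.smul_apply, map_smul]
    have : FilLt n ((iotaHom K V π ^ (j + 1)) x) := by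
      apply Fil_D_pow hπ
      intro k hk
      exact hF k (by omega)
    rw [this n le_rfl]
    simp

theorem unique_sol [CharZero K] [FiniteDimensional K V] (s : Module.Dual K V → V)
    {y : ExteriorAlgebra K (Module.Dual K V)}
    (hy : ∀ γ, ExteriorAlgebra.ι K γ * y + cl (Module.Dual.eval K V (s γ)) y = 0)
    (h0 : pr (Module.finrank K (Module.Dual K V)) y = 0) : y = 0 := by
  have h : ∀ m k, Module.finrank K (Module.Dual K V) ≤ k + m → pr k y = 0 := by
    intro m
    induction m with
    | zero =>
      intro k hk
      rcases eq_or_lt_of_le hk with hk | hk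
      · have : k = Module.finrank K (Module.Dual K V) := by omega
        rw [this]; exact h0
      · exact pr_big (by omega) y
    | succ m ih =>
      intro k hk
      by_cases hk' : k = Module.finrank K (Module.Dual K V)
      · rw [hk']; exact h0
      · apply zero_of_ι_mul hk'
        intro γ
        have h1 := congrArg (pr (k + 1)) (hy γ)
        rw [map_add, pr_succ_ι_mul, pr_cl, ih (k + 1 + 1) (by omega), map_zero, map_zero,
          add_zero] at h1
        exact h1
  exact ext_pr fun k => h (Module.finrank K (Module.Dual K V)) k (by omega)

theorem rho_eq (w : V × Module.Dual K V) (x : ExteriorAlgebra K (Module.Dual K V)) :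
    cliffordRho w x = cl (Module.Dual.eval K V w.1) x + ExteriorAlgebra.ι K w.2 * x := rfl

theorem rho_add (w u : V × Module.Dual K V) (x : ExteriorAlgebra K (Module.Dual K V)) :
    cliffordRho (w + u) x = cliffordRho w x + cliffordRho u x := by
  simp only [rho_eq, Prod.fst_add, Prod.snd_add, map_add, cl_add, LinearMap.add_apply, add_mul]
  abel

/-- `cliffordRho` as a linear map. -/
noncomputable def rhoL (w : V × Module.Dual K V) :
    ExteriorAlgebra K (Module.Dual K V) →ₗ[K] ExteriorAlgebra K (Module.Dual K V) :=
  cl (Module.Dual.eval K V w.1) + LinearMap.mulLeft K (ExteriorAlgebra.ι K w.2)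

theorem rhoL_eq (w : V × Module.Dual K V) (x : ExteriorAlgebra K (Module.Dual K V)) :
    rhoL w x = cliffordRho w x := rfl

theorem rhoL_comm (w u : V × Module.Dual K V) (x : ExteriorAlgebra K (Module.Dual K V)) :
    rhoL w (rhoL u x) = (w.2 u.1 + u.2 w.1) • x - rhoL u (rhoL w x) := by
  simp only [rhoL_eq, rho_eq, map_add, cl_ι_mul, mul_add, Module.Dual.eval_apply, add_smul,
    ← mul_assoc]
  rw [cl_comm (Module.Dual.eval K V w.1), ι_swap w.2 u.2]
  simp only [neg_mul]
  abel

theorem revE_rel {w : V × Module.Dual K V} {φ : ExteriorAlgebra K (Module.Dual K V)}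
    (h : cliffordRho w φ = 0) :
    cl (Module.Dual.eval K V w.1) (rv φ) = ExteriorAlgebra.ι K w.2 * rv φ := by
  rw [rho_eq] at h
  have h1 := congrArg (fun z => inv' (rv z)) h
  simp only [map_add, rv_cl, rv_mul, rv_ι, inv_inv, map_zero, map_mul, inv_ι] at h1
  have h2 : inv' (rv φ) * ExteriorAlgebra.ι K w.2 = ExteriorAlgebra.ι K w.2 * rv φ := by
    rw [mul_ι_eq, inv_inv]
  rw [mul_neg, h2, ← sub_eq_add_neg, sub_eq_zero] at h1
  exact h1

theorem chi_rel {φ ψ : ExteriorAlgebra K (Module.Dual K V)} {v : V} {α β : Module.Dual K V}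
    (h1 : cliffordRho (v, α) φ = 0) (h2 : cliffordRho (v, β) ψ = 0) :
    cl (Module.Dual.eval K V v) (rv φ * ψ) = ExteriorAlgebra.ι K (α - β) * (rv φ * ψ) := by
  have h3 := revE_rel h1
  rw [rho_eq] at h2
  have h4 := eq_neg_of_add_eq_zero_left h2
  dsimp only at h3 h4
  rw [cl_mul, h3, h4, map_sub, sub_mul, mul_neg, ← mul_assoc _ (ExteriorAlgebra.ι K β), mul_ι_eq,
    inv_inv, mul_assoc, mul_assoc]
  abel

theorem top_rho [FiniteDimensional K V] {w : V × Module.Dual K V}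
    {φ : ExteriorAlgebra K (Module.Dual K V)}
    (h : cliffordRho w φ = 0) (x : ExteriorAlgebra K (Module.Dual K V)) :
    pr (Module.finrank K (Module.Dual K V)) (rv φ * rhoL w x) = 0 := by
  have h3 := revE_rel h
  have h4 : rv φ * rhoL w x = cl (Module.Dual.eval K V w.1) (inv' (rv φ) * x) := by
    rw [rhoL_eq, rho_eq, cl_mul, cl_inv, h3, inv_inv, map_mul, inv_ι, mul_add, ← mul_assoc,
      mul_ι_eq]
    simp only [neg_mul, neg_neg]
    abel
  rw [h4, pr_cl, pr_big (by omega), map_zero]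

/-- The elements obtained from `ψ` by repeated action of `E`. -/
inductive Orb (E : Submodule K (V × Module.Dual K V)) (ψ : ExteriorAlgebra K (Module.Dual K V)) :
    ExteriorAlgebra K (Module.Dual K V) → Prop
  | base : Orb E ψ ψ
  | step (e x) (he : e ∈ E) (hx : Orb E ψ x) : Orb E ψ (rhoL e x)

theorem top_ne [CharZero K] [FiniteDimensional K V]
    {φ ψ : ExteriorAlgebra K (Module.Dual K V)} (hφ0 : φ ≠ 0) (hψ0 : ψ ≠ 0)
    {E F : Submodule K (V × Module.Dual K V)}
    (hEφ : ∀ w ∈ E, cliffordRho w φ = 0)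
    (hFψ : ∀ w ∈ F, cliffordRho w ψ = 0) (hEF : E ⊔ F = ⊤) :
    pr (Module.finrank K (Module.Dual K V)) (rv φ * ψ) ≠ 0 := by
  intro h0
  let N := Submodule.span K {x | Orb E ψ x}
  have hE : ∀ e ∈ E, ∀ x ∈ N, rhoL e x ∈ N := by
    intro e he x hx
    have : N ≤ N.comap (rhoL e) := by
      refine Submodule.span_le.2 ?_
      intro y hy
      exact Submodule.subset_span (Orb.step e y he hy)
    exact this hx
  have hF : ∀ f ∈ F, ∀ x ∈ N, rhoL f x ∈ N := by
    intro f hf x hx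
    have : N ≤ N.comap (rhoL f) := by
      refine Submodule.span_le.2 ?_
      intro y hy
      change rhoL f y ∈ N
      induction hy with
      | base => rw [rhoL_eq, hFψ f hf]; exact N.zero_mem
      | step e x he hx ih =>
        rw [rhoL_comm]
        exact N.sub_mem (N.smul_mem _ (Submodule.subset_span hx)) (hE e he _ ih)
    exact this hx
  have hall : ∀ w, ∀ x ∈ N, rhoL w x ∈ N := by
    intro w x hx
    have hw : w ∈ E ⊔ F := by rw [hEF]; trivial
    obtain ⟨e, he, f, hf, rfl⟩ := Submodule.mem_sup.1 hw
    rw [rhoL_eq, rho_add]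
    exact N.add_mem (hE e he x hx) (hF f hf x hx)
  have htop : ∀ y, y ∈ N := by
    refine irred N hψ0 (Submodule.subset_span Orb.base) ?_ ?_
    · intro d y hy
      obtain ⟨v, rfl⟩ := (Module.evalEquiv K V).surjective d
      have := hall (v, 0) y hy
      rw [rhoL_eq, rho_eq] at this
      simpa using this
    · intro a y hy
      have := hall (0, a) y hy
      rw [rhoL_eq, rho_eq] at this
      have hz : cl (0 : Module.Dual K (Module.Dual K V)) y = 0 := by
        have := cl_add (0 : Module.Dual K (Module.Dual K V)) 0
        rw [add_zero] at this
        have h2 := congrArg (fun f => f y) this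
        simpa using h2
      simpa [hz] using this
  have hL : N ≤ LinearMap.ker ((pr (Module.finrank K (Module.Dual K V))).comp
      (LinearMap.mulLeft K (rv φ))) := by
    refine Submodule.span_le.2 ?_
    intro y hy
    change pr (Module.finrank K (Module.Dual K V)) (rv φ * y) = 0
    cases hy with
    | base => exact h0
    | step e x he hx => exact top_rho (hEφ e he) x
  have hrv : rv φ ≠ 0 := by
    intro h
    apply hφ0
    rw [← rv_rv φ, h, map_zero]
  obtain ⟨y, hy⟩ := nondeg hrv
  exact hy (hL (htop y))

end Spin

end PureSpin

/-- for a Lagrangian splitting `𝕍 = E ⊕ F` defined by pure spinors `φ, ψ`,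
with bivector `π`, one has `φᵀ ∧ ψ = exp(-ι(π)) (φᵀ ∧ ψ)^[top]`, where the top-degree
component `(φᵀ ∧ ψ)^[top]` is nonzero. -/
theorem pure_spinors_stmt13 {K V : Type*} [Field K] [CharZero K] [AddCommGroup V] [Module K V]
    [FiniteDimensional K V]
    (φ ψ : ExteriorAlgebra K (Module.Dual K V)) (hφ0 : φ ≠ 0) (hψ0 : ψ ≠ 0)
    (E F : Submodule K (V × Module.Dual K V))
    (hEφ : ∀ w, w ∈ E ↔ cliffordRho w φ = 0)
    (hFψ : ∀ w, w ∈ F ↔ cliffordRho w ψ = 0)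
    (hElag : ∀ w : V × Module.Dual K V, w ∈ E ↔ ∀ u ∈ E, w.2 u.1 + u.2 w.1 = 0)
    (hFlag : ∀ w : V × Module.Dual K V, w ∈ F ↔ ∀ u ∈ F, w.2 u.1 + u.2 w.1 = 0)
    (hcompl : IsCompl E F)
    (p : (V × Module.Dual K V) →ₗ[K] (V × Module.Dual K V))
    (hpE : ∀ w ∈ E, p w = w) (hpF : ∀ w ∈ F, p w = 0)
    (π : ExteriorAlgebra K V) (hπdeg : π ∈ (⋀[K]^2 V))
    (hπ : ∀ α : Module.Dual K V,
      CliffordAlgebra.contractLeft α π = ExteriorAlgebra.ι K (-(p ((0 : V), α)).1)) :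
    GradedAlgebra.proj (fun i : ℕ => ⋀[K]^i (Module.Dual K V)) (Module.finrank K V)
        (revE φ * ψ) ≠ 0 ∧
    revE φ * ψ =
      expA (K := K) (Module.finrank K V) (-(iotaHom K V π))
        (GradedAlgebra.proj (fun i : ℕ => ⋀[K]^i (Module.Dual K V)) (Module.finrank K V)
          (revE φ * ψ)) := by
  have hn : Module.finrank K V = Module.finrank K (Module.Dual K V) :=
    Subspace.dual_finrank_eq.symm
  have hne := PureSpin.top_ne hφ0 hψ0 (fun w hw => (hEφ w).1 hw) (fun w hw => (hFψ w).1 hw)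
    hcompl.sup_eq_top
  rw [hn]
  refine ⟨hne, ?_⟩
  change PureSpin.rv φ * ψ = expA (K := K) (Module.finrank K (Module.Dual K V))
    (-(iotaHom K V π)) (PureSpin.pr (Module.finrank K (Module.Dual K V)) (PureSpin.rv φ * ψ))
  have hF : PureSpin.FilLt (Module.finrank K (Module.Dual K V) + 1)
      (PureSpin.pr (Module.finrank K (Module.Dual K V)) (PureSpin.rv φ * ψ)) :=
    fun k hk => PureSpin.pr_big (by omega) _
  rw [← sub_eq_zero]
  refine PureSpin.unique_sol (fun γ => -(p ((0 : V), γ)).1) (fun γ => ?_) ?_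
  · have h1 : ExteriorAlgebra.ι K γ * (PureSpin.rv φ * ψ) +
        PureSpin.cl (Module.Dual.eval K V (-(p ((0 : V), γ)).1)) (PureSpin.rv φ * ψ) = 0 := by
      have hw : ((0 : V), γ) ∈ E ⊔ F := by rw [hcompl.sup_eq_top]; trivial
      obtain ⟨e, he, f, hf, hef⟩ := Submodule.mem_sup.1 hw
      have hp : p ((0 : V), γ) = e := by rw [← hef, map_add, hpE e he, hpF f hf, add_zero]
      obtain ⟨v, α⟩ := e
      obtain ⟨u, β⟩ := f
      simp only [Prod.mk_add_mk, Prod.mk.injEq] at hef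
      have hu : u = -v := eq_neg_of_add_eq_zero_right hef.1
      have hf' : (v, -β) ∈ F := by
        have := F.neg_mem hf
        simpa [hu] using this
      have h2 := PureSpin.chi_rel ((hEφ _).1 he) ((hFψ _).1 hf')
      rw [sub_neg_eq_add, hef.2] at h2
      rw [hp, ← h2, ← LinearMap.add_apply, ← PureSpin.cl_add, ← map_add]
      dsimp only
      rw [add_neg_cancel, map_zero]
      have h3 := PureSpin.cl_add (0 : Module.Dual K (Module.Dual K V)) 0
      rw [add_zero] at h3
      have h4 := congrArg (fun f => f (PureSpin.rv φ * ψ)) h3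
      simpa using h4
    have h2 := PureSpin.exp_solves hπdeg (hπ γ) (Module.finrank K (Module.Dual K V))
      (x := PureSpin.pr (Module.finrank K (Module.Dual K V)) (PureSpin.rv φ * ψ))
      (by rw [← PureSpin.pr_succ_ι_mul, PureSpin.pr_big (by omega)]) hF
    rw [mul_sub, map_sub, sub_add_sub_comm, h1, h2, sub_zero]
  · rw [map_sub, PureSpin.pr_exp hπdeg _ hF, PureSpin.pr_pr, sub_self]
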